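/- (Lower bound.) For every fixed even positive integer m, there exists a constant C₁(m) > 0 depending only on m such that for all sufficiently large even n, α(m,n) > C₁(m) · C(m, m/2)ⁿ / n^{(m-1)/2}, where C(a,b) denotes the binomial coefficient. -/

import Mathlib

open Finset

/-- A ±1 matrix: every entry is 1 or -1. -/
def IsPM {m n : ℕ} (M : Matrix (Fin m) (Fin n) ℤ) : Prop :=
  ∀ i j, M i j = 1 ∨ M i j = -1

/-- `goodA m n` is the set A(m,n) of m×n ±1 matrices all of whose row sums and
column sums have absolute value at most 1. -/
def goodA (m n : ℕ) : Set (Matrix (Fin m) (Fin n) ℤ) :=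
  {M | IsPM M ∧ (∀ i, |∑ j, M i j| ≤ 1) ∧ (∀ j, |∑ i, M i j| ≤ 1)}

/-- `alpha m n = |A(m,n)|`. -/
noncomputable def alpha (m n : ℕ) : ℕ := (goodA m n).ncard

/-- The `±1` vector that is `1` on `s` and `-1` off `s`. -/
def signVec {m : ℕ} (s : Finset (Fin m)) (i : Fin m) : ℤ := if i ∈ s then 1 else -1

lemma signVec_eq_or {m : ℕ} (s : Finset (Fin m)) (i : Fin m) :
    signVec s i = 1 ∨ signVec s i = -1 := by
  unfold signVec; split_ifs <;> simp

lemma signVec_sq {m : ℕ} (s : Finset (Fin m)) (i : Fin m) : signVec s i ^ 2 = 1 := by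
  rcases signVec_eq_or s i with h | h <;> simp [h]

lemma signVec_injective {m : ℕ} : Function.Injective (signVec (m := m)) := by
  intro s t h
  ext i
  have := congrFun h i
  unfold signVec at this
  split_ifs at this <;> simp_all

lemma signVec_compl {m : ℕ} (s : Finset (Fin m)) (i : Fin m) :
    signVec sᶜ i = -signVec s i := by
  by_cases h : i ∈ s <;> simp [signVec, h]

lemma sum_signVec {m : ℕ} (s : Finset (Fin m)) : ∑ i, signVec s i = 2 * (#s : ℤ) - m := by
  have h (i : Fin m) : signVec s i = 2 * (if i ∈ s then 1 else 0) - 1 := by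
    unfold signVec; split_ifs <;> rfl
  simp [h, Finset.sum_sub_distrib, mul_comm]

/-- The subsets of `Fin m` of size `m / 2`, encoding the balanced `±1` vectors for even `m`. -/
abbrev HalfSet (m : ℕ) := {s : Finset (Fin m) // #s = m / 2}

lemma card_halfSet (m : ℕ) : Fintype.card (HalfSet m) = m.choose (m / 2) := by
  simp

lemma sum_signVec_halfSet {m : ℕ} (hm : Even m) (s : HalfSet m) :
    ∑ i, signVec s.1 i = 0 := by
  rw [sum_signVec, s.2]
  obtain ⟨k, rfl⟩ := hm
  omega

lemma sum_halfSet_signVec {m : ℕ} (hm : Even m) (i : Fin m) :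
    ∑ s : HalfSet m, signVec s.1 i = 0 := by
  have hc (s : HalfSet m) : #(s.1ᶜ) = m / 2 := by
    rw [card_compl, s.2, Fintype.card_fin]
    obtain ⟨k, rfl⟩ := hm
    omega
  let e : HalfSet m ≃ HalfSet m :=
    { toFun := fun s => ⟨s.1ᶜ, hc s⟩
      invFun := fun s => ⟨s.1ᶜ, hc s⟩
      left_inv := fun s => by simp
      right_inv := fun s => by simp }
  have h := e.sum_comp fun s => signVec s.1 i
  simp only [e, Equiv.coe_fn_mk, signVec_compl, Finset.sum_neg_distrib] at h
  omega

/-- For a centred `x` with `x ^ 2 = 1`, the variance of a sum of `k` independent copies is `k`. -/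
lemma sum_sq_sum_words {T : Type*} [Fintype T] (x : T → ℤ) (h0 : ∑ t, x t = 0)
    (h1 : ∀ t, x t ^ 2 = 1) (k : ℕ) :
    ∑ w : Fin k → T, (∑ j, x (w j)) ^ 2 = k * (Fintype.card T : ℤ) ^ k := by
  induction k with
  | zero => simp
  | succ k ih =>
    rw [← (Fin.consEquiv fun _ => T).sum_comp, Fintype.sum_prod_type]
    have h (t : T) (w : Fin k → T) : (x t + ∑ j, x (w j)) ^ 2 =
        1 + 2 * (x t * ∑ j, x (w j)) + (∑ j, x (w j)) ^ 2 := by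
      rw [← h1 t]; ring
    simp only [Fin.consEquiv_apply, Fin.sum_univ_succ, Fin.cons_zero, Fin.cons_succ, h,
      Finset.sum_add_distrib, ih, ← Finset.mul_sum, ← Finset.sum_mul, h0]
    simp
    ring

/-- Chebyshev's inequality for the column sums of words in balanced `±1` vectors. -/
lemma card_le_two_mul_card_bounded {m k : ℕ} (hm : Even m) (hm0 : 0 < m) (hk : 0 < k) :
    (m.choose (m / 2)) ^ k ≤
      2 * #{w : Fin k → HalfSet m | ∀ i, (∑ j, signVec (w j).1 i) ^ 2 ≤ 2 * m * k} := by
  set b := m.choose (m / 2)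
  set p : (Fin k → HalfSet m) → Prop := fun w => ∀ i, (∑ j, signVec (w j).1 i) ^ 2 ≤ 2 * m * k
  have htot : ∑ w : Fin k → HalfSet m, ∑ i, (∑ j, signVec (w j).1 i) ^ 2 =
      m * (k * (b : ℤ) ^ k) := by
    rw [Finset.sum_comm]
    have (i : Fin m) := sum_sq_sum_words (fun s : HalfSet m => signVec s.1 i)
      (sum_halfSet_signVec hm i) (fun s => signVec_sq s.1 i) k
    simp only [this, card_halfSet]
    simp [b]
  have hbad : (#{w | ¬ p w} : ℤ) * (2 * m * k) ≤ m * (k * (b : ℤ) ^ k) := by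
    rw [← htot, ← nsmul_eq_mul]
    refine (Finset.card_nsmul_le_sum _ _ _ fun w hw => ?_).trans
      (Finset.sum_le_sum_of_subset_of_nonneg (Finset.filter_subset _ _)
        fun w _ _ => Finset.sum_nonneg fun i _ => sq_nonneg _)
    simp only [p, Finset.mem_filter, Finset.mem_univ, true_and, not_forall, not_le] at hw
    obtain ⟨i, hi⟩ := hw
    exact hi.le.trans (Finset.single_le_sum (f := fun i => (∑ j, signVec (w j).1 i) ^ 2)
      (fun i _ => sq_nonneg _) (Finset.mem_univ i))
  have hbad' : 2 * #{w | ¬ p w} ≤ b ^ k := by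
    have hmk : 0 < (m * k : ℤ) := by positivity
    have : (2 * #{w | ¬ p w} : ℤ) ≤ (b : ℤ) ^ k := by
      refine le_of_mul_le_mul_left ?_ hmk
      linarith
    exact_mod_cast this
  have hsum := Finset.card_filter_add_card_filter_not (s := (univ : Finset (Fin k → HalfSet m))) p
  have hcard : #(univ : Finset (Fin k → HalfSet m)) = b ^ k := by
    rw [Finset.card_univ, Fintype.card_fun, card_halfSet, Fintype.card_fin]
  have hgood : b ^ k ≤ 2 * #(univ.filter p) := by omega
  convert hgood

/-- By Cauchy–Schwarz, a map into a set of size `#t` has at least `#s ^ 2 / #t` collisions. -/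
lemma card_sq_le_card_mul_card_collisions {α β : Type*} [DecidableEq β] (s : Finset α)
    (t : Finset β) (f : α → β) (hf : ∀ a ∈ s, f a ∈ t) :
    #s ^ 2 ≤ #t * #{p ∈ s ×ˢ s | f p.1 = f p.2} := by
  have h : #{p ∈ s ×ˢ s | f p.1 = f p.2} = ∑ b ∈ t, #{a ∈ s | f a = b} ^ 2 := by
    rw [Finset.card_eq_sum_card_fiberwise (f := fun p => f p.1) (t := t)]
    · refine Finset.sum_congr rfl fun b _ => ?_
      rw [sq, ← Finset.card_product]
      congr 1
      ext ⟨x, y⟩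
      simp only [Finset.mem_filter, Finset.mem_product]
      grind
    · intro p hp
      simp only [Finset.coe_filter, Finset.mem_product, Set.mem_ofPred_eq] at hp
      exact hf _ hp.1.1
  rw [h, Finset.card_eq_sum_card_fiberwise (f := f) (t := t) hf]
  exact sq_sum_le_card_mul_sum_sq

lemma goodA_finite (m n : ℕ) : (goodA m n).Finite := by
  refine (Set.Finite.pi fun _ : Fin m => Set.Finite.pi fun _ : Fin n =>
    Set.toFinite ({1, -1} : Set ℤ)).subset ?_
  intro M hM
  simp only [Set.mem_pi, Set.mem_univ, forall_true_left]
  exact fun i j => hM.1 i j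

/-- Two words of balanced vectors with equal sums give an element of `goodA m (k + k)`:
list the first word followed by the negative of the second. -/
lemma card_collisions_le_alpha {m k : ℕ} (hm : Even m)
    (s : Finset ((Fin k → HalfSet m) × (Fin k → HalfSet m)))
    (hs : ∀ p ∈ s, ∀ i, ∑ j, signVec (p.1 j).1 i = ∑ j, signVec (p.2 j).1 i) :
    #s ≤ alpha m (k + k) := by
  let F : (Fin k → HalfSet m) × (Fin k → HalfSet m) → Matrix (Fin m) (Fin (k + k)) ℤ :=
    fun p i => Fin.append (fun j => signVec (p.1 j).1 i) (fun j => -signVec (p.2 j).1 i)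
  have hF : Function.Injective F := by
    rintro ⟨u, v⟩ ⟨u', v'⟩ h
    have h' (i j) : F (u, v) i j = F (u', v') i j := by rw [h]
    refine Prod.ext (funext fun j => ?_) (funext fun j => ?_)
    · refine Subtype.ext (signVec_injective (funext fun i => ?_))
      simpa [F] using h' i (Fin.castAdd k j)
    · refine Subtype.ext (signVec_injective (funext fun i => ?_))
      simpa [F, -Fin.natAdd_eq_addNat] using h' i (Fin.natAdd k j)
  rw [← Set.ncard_coe_finset, ← Set.ncard_image_of_injective _ hF]
  refine Set.ncard_le_ncard ?_ (goodA_finite _ _)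
  rintro _ ⟨p, hp, rfl⟩
  refine ⟨fun i j => ?_, fun i => ?_, fun j => ?_⟩
  · refine Fin.addCases (fun j => ?_) (fun j => ?_) j
    · simpa [F] using signVec_eq_or _ _
    · simpa [F, -Fin.natAdd_eq_addNat, neg_eq_iff_eq_neg, or_comm] using signVec_eq_or (p.2 j).1 i
  · simp [F, -Fin.natAdd_eq_addNat, Fin.sum_univ_add, hs p hp i]
  · refine Fin.addCases (fun j => ?_) (fun j => ?_) j
    · simp [F, sum_signVec_halfSet hm]
    · simp [F, -Fin.natAdd_eq_addNat, sum_signVec_halfSet hm]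

lemma choose_pow_le_alpha {d k : ℕ} (hm : Even (d + 1)) (hk : 0 < k) :
    ((d + 1).choose ((d + 1) / 2)) ^ (k + k) ≤
      4 * ((2 * Nat.sqrt (2 * (d + 1) * k) + 1) ^ d * alpha (d + 1) (k + k)) := by
  set r := Nat.sqrt (2 * (d + 1) * k)
  set G : Finset (Fin k → HalfSet (d + 1)) :=
    {w | ∀ i, (∑ j, signVec (w j).1 i) ^ 2 ≤ 2 * (d + 1 : ℕ) * k}
  have hG := card_le_two_mul_card_bounded hm d.succ_pos hk
  let f : (Fin k → HalfSet (d + 1)) → Fin d → ℤ := fun w i => ∑ j, signVec (w j).1 i.castSucc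
  let t : Finset (Fin d → ℤ) := Fintype.piFinset fun _ => Icc (-r : ℤ) r
  have hft : ∀ w ∈ G, f w ∈ t := by
    intro w hw
    rw [Fintype.mem_piFinset]
    intro i
    rw [Finset.mem_Icc, ← abs_le]
    have h := (Finset.mem_filter.1 hw).2 i.castSucc
    have : (f w i).natAbs ≤ r := by
      rw [Nat.le_sqrt']
      zify
      rw [sq_abs]
      simpa [f] using h
    rw [Int.abs_eq_natAbs]
    exact_mod_cast this
  have ht : #t = (2 * r + 1) ^ d := by
    simp only [t, Fintype.card_piFinset_const, Int.card_Icc]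
    congr 1
    omega
  have hcol := card_sq_le_card_mul_card_collisions G t f hft
  have hα : #{p ∈ G ×ˢ G | f p.1 = f p.2} ≤ alpha (d + 1) (k + k) := by
    refine card_collisions_le_alpha hm _ fun p hp => ?_
    have hp := (Finset.mem_filter.1 hp).2
    have hzero (w : Fin k → HalfSet (d + 1)) : ∑ i, ∑ j, signVec (w j).1 i = 0 := by
      rw [Finset.sum_comm]
      exact Finset.sum_eq_zero fun j _ => sum_signVec_halfSet hm (w j)
    have h1 := hzero p.1
    have h2 := hzero p.2
    rw [Fin.sum_univ_castSucc] at h1 h2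
    have hcast (i : Fin d) : ∑ j, signVec (p.1 j).1 i.castSucc =
      ∑ j, signVec (p.2 j).1 i.castSucc := congrFun hp i
    refine Fin.lastCases ?_ hcast
    simp only [hcast] at h1
    linarith
  rw [ht] at hcol
  calc ((d + 1).choose ((d + 1) / 2)) ^ (k + k)
      = (((d + 1).choose ((d + 1) / 2)) ^ k) ^ 2 := by ring
    _ ≤ (2 * #G) ^ 2 := Nat.pow_le_pow_left hG 2
    _ = 4 * #G ^ 2 := by ring
    _ ≤ _ := Nat.mul_le_mul_left 4 (hcol.trans (Nat.mul_le_mul_left _ hα))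

theorem stmt18 (m : ℕ) (hm : Even m) (hm0 : 0 < m) :
    ∃ C : ℝ, 0 < C ∧ ∃ N : ℕ, ∀ n ≥ N, Even n →
      C * (Nat.choose m (m / 2) : ℝ) ^ n / (n : ℝ) ^ (((m : ℝ) - 1) / 2) < (alpha m n : ℝ) := by
  obtain ⟨d, rfl⟩ : ∃ d, m = d + 1 := ⟨m - 1, by omega⟩
  set K : ℝ := (3 * √(d + 1 : ℝ)) ^ d
  have hK : 0 < K := by positivity
  refine ⟨1 / (8 * K), by positivity, 1, ?_⟩
  rintro _ hn ⟨k, rfl⟩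
  have hk : 0 < k := by omega
  have hpow : ((k + k : ℕ) : ℝ) ^ (((d + 1 : ℕ) - 1 : ℝ) / 2) = √((k + k : ℕ) : ℝ) ^ d := by
    rw [Real.sqrt_eq_rpow, ← Real.rpow_natCast, ← Real.rpow_mul (by positivity)]
    congr 1
    push_cast
    ring
  have hr : (2 * (Nat.sqrt (2 * (d + 1) * k) : ℝ) + 1) ≤
      3 * √(d + 1 : ℝ) * √((k + k : ℕ) : ℝ) := by
    have h1 : (Nat.sqrt (2 * (d + 1) * k) : ℝ) ≤ √(d + 1 : ℝ) * √((k + k : ℕ) : ℝ) := by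
      rw [← Real.sqrt_mul (by positivity)]
      refine Real.nat_sqrt_le_real_sqrt.trans (le_of_eq ?_)
      congr 1
      push_cast
      ring
    have h2 : (1 : ℝ) ≤ Nat.sqrt (2 * (d + 1) * k) := by
      exact_mod_cast Nat.sqrt_pos.2 (by positivity)
    linarith
  have hmain : ((d + 1).choose ((d + 1) / 2) : ℝ) ^ (k + k) ≤
      4 * ((2 * (Nat.sqrt (2 * (d + 1) * k) : ℝ) + 1) ^ d * alpha (d + 1) (k + k)) := by
    exact_mod_cast choose_pow_le_alpha hm hk
  have hS : 0 < √((k + k : ℕ) : ℝ) ^ d := by positivity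
  have hbound : (2 * (Nat.sqrt (2 * (d + 1) * k) : ℝ) + 1) ^ d ≤ K * √((k + k : ℕ) : ℝ) ^ d := by
    rw [← mul_pow]
    exact pow_le_pow_left₀ (by positivity) hr d
  have hb : 0 < ((d + 1).choose ((d + 1) / 2) : ℝ) ^ (k + k) := by
    have := Nat.choose_pos (Nat.div_le_self (d + 1) 2)
    positivity
  have hle := hmain.trans (mul_le_mul_of_nonneg_left
    (mul_le_mul_of_nonneg_right hbound (Nat.cast_nonneg _)) (by norm_num))
  rw [hpow, div_lt_iff₀ hS, div_mul_eq_mul_div, div_lt_iff₀ (by positivity)]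
  nlinarith
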